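/- Let p and q be odd primes, m ≥ 1, and let x, y be coprime positive integers with x² + q^(2m) = 2·y^p. Suppose there exist integers u, v with y = u² + v², x = F_p(u,v), q^m = G_p(u,v), and u + δ4·v = q^m or u + δ4·v = −q^m. If q^m ≥ 503, then p ≤ 3803. -/

import Mathlib

/-- `δ₄ = 1` if `p ≡ 1 (mod 4)` and `δ₄ = -1` if `p ≡ 3 (mod 4)`. -/
def d4 (p : ℕ) : ℤ := if p % 4 = 1 then 1 else -1

/-- `δ₈ = 1` if `p ≡ 1, 3 (mod 8)` and `δ₈ = -1` if `p ≡ 5, 7 (mod 8)`. -/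
def d8 (p : ℕ) : ℤ := if p % 8 = 1 ∨ p % 8 = 3 then 1 else -1

/-- `F_p(u,v) = Re((1+i)(u+iv)^p)`. -/
def Ffun (p : ℕ) (u v : ℤ) : ℤ :=
  ((⟨1, 1⟩ : GaussianInt) * (⟨u, v⟩ : GaussianInt) ^ p).re

/-- `G_p(u,v) = Im((1+i)(u+iv)^p)`. -/
def Gfun (p : ℕ) (u v : ℤ) : ℤ :=
  ((⟨1, 1⟩ : GaussianInt) * (⟨u, v⟩ : GaussianInt) ^ p).im

/-- `H_p(u,v) = G_p(u,v)/(u + δ₄ v)` (exact division whenever `u + δ₄ v ≠ 0`). -/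
def Hfun (p : ℕ) (u v : ℤ) : ℤ := Gfun p u v / (u + d4 p * v)

open Polynomial

theorem exists_minor {ι P : Type*} [Fintype ι] [DecidableEq ι] (f : ι → P → ℂ)
    (h : ∀ c : ι → ℂ, (∀ x, ∑ i, c i * f i x = 0) → c = 0) :
    ∃ e : ι → P, (Matrix.of fun i j => f i (e j)).det ≠ 0 := by
  classical
  let v : P → ι → ℂ := fun x i => f i x
  have hspan : Submodule.span ℂ (Set.range v) = ⊤ := by
    by_contra hne
    obtain ⟨φ, hφ0, hφ⟩ := Submodule.exists_le_ker_of_lt_top _ (lt_top_iff_ne_top.mpr hne)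
    apply hφ0
    have hc := h (fun i => φ (Pi.single i 1)) (fun x => by
      have h1 : φ (v x) = 0 := hφ (Submodule.subset_span ⟨x, rfl⟩)
      rw [LinearMap.pi_apply_eq_sum_univ φ (v x)] at h1
      rw [← h1]
      apply Finset.sum_congr rfl
      intro i _
      have : (fun j => if i = j then (1:ℂ) else 0) = Pi.single i 1 := by
        ext j; simp [Pi.single_apply, eq_comm]
      rw [this, smul_eq_mul, mul_comm])
    apply LinearMap.ext
    intro w
    rw [LinearMap.pi_apply_eq_sum_univ φ w]
    apply Finset.sum_eq_zero
    intro i _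
    have : (fun j => if i = j then (1:ℂ) else 0) = Pi.single i 1 := by
      ext j; simp [Pi.single_apply, eq_comm]
    rw [this]
    have := congrFun hc i
    simp only [Pi.zero_apply] at this
    rw [this, smul_zero]
  obtain ⟨b, hb, hbs, hbl⟩ := exists_linearIndependent ℂ (Set.range v)
  rw [hspan] at hbs
  let B : Module.Basis b ℂ (ι → ℂ) := Module.Basis.mk hbl (by simp [hbs])
  let σ : ι ≃ b := (Pi.basisFun ℂ ι).indexEquiv B
  have hch : ∀ j : ι, ∃ x, v x = (σ j : ι → ℂ) := fun j => hb (σ j).2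
  choose e he using hch
  refine ⟨e, ?_⟩
  have hl : LinearIndependent ℂ (fun j : ι => v (e j)) := by
    have : (fun j : ι => v (e j)) = (fun x : b => (x : ι → ℂ)) ∘ σ := by
      ext j i; simp [he]
    rw [this]
    exact hbl.comp _ σ.injective
  have hM : IsUnit (Matrix.of fun j i => f i (e j)) :=
    Matrix.linearIndependent_rows_iff_isUnit.mp hl
  have := (Matrix.isUnit_iff_isUnit_det _).mp hM
  rw [← Matrix.det_transpose] at this
  exact this.ne_zero

theorem zero_estimate {L : ℕ} {β : Type*} [DecidableEq β] (D : ℕ) (q : Fin L → ℂ[X])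
    (hdeg : ∀ l, (q l).natDegree ≤ D)
    (na wa : Fin L → ℂ) (hwa : Function.Injective wa)
    (B : Finset β) (nb wb : β → ℂ) (hnb : Set.InjOn nb B) (hwb : ∀ b ∈ B, wb b ≠ 0)
    (hcard : L * D < B.card)
    (hz : ∀ a, ∀ b ∈ B, ∑ l : Fin L, (q l).eval (nb b + na a) * (wa a * wb b) ^ (l : ℕ) = 0) :
    ∀ l, q l = 0 := by
  classical
  by_contra hne
  push Not at hne
  obtain ⟨l0, hl0⟩ := hne
  let S := {l : Fin L // q l ≠ 0}
  have hsub : ∀ g : Fin L → ℂ, (∀ l, q l = 0 → g l = 0) → ∑ i : S, g i = ∑ l, g l := by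
    intro g hg
    rw [← Finset.sum_subtype (Finset.univ.filter (fun l => q l ≠ 0)) (by simp) g]
    apply Finset.sum_filter_of_ne
    intro l _ hl h0
    exact hl (hg l h0)
  have hli : ∀ c : S → ℂ, (∀ a : Fin L, ∑ i : S, c i * (wa a) ^ ((i : Fin L) : ℕ) = 0) → c = 0 := by
    intro c hc
    let c' : Fin L → ℂ := fun l => if h : q l ≠ 0 then c ⟨l, h⟩ else 0
    have hV : (Matrix.vandermonde wa).det ≠ 0 := Matrix.det_vandermonde_ne_zero_iff.mpr hwa
    have : c' = 0 := by
      apply Matrix.eq_zero_of_mulVec_eq_zero hV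
      ext a
      simp only [Matrix.mulVec, dotProduct, Matrix.vandermonde_apply, Pi.zero_apply]
      rw [← hc a]
      rw [← hsub _ (fun l hl => by simp [c', hl])]
      apply Finset.sum_congr rfl
      intro i _
      have := i.2
      simp [c', this, mul_comm]
    ext ⟨l, hl⟩
    have := congrFun this l
    simpa [c', hl] using this
  obtain ⟨e, he⟩ := exists_minor (fun (i : S) (a : Fin L) => (wa a) ^ ((i : Fin L) : ℕ)) hli
  let M : Matrix S S ℂ[X] := Matrix.of fun i j =>
    X ^ (D - (q i).natDegree) * (q i).comp (X + C (na (e j))) * C (wa (e j) ^ ((i : Fin L) : ℕ))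
  have hentry : ∀ i j, (M i j).natDegree ≤ D := by
    intro i j
    have h1 := hdeg i
    calc (M i j).natDegree ≤ (X ^ (D - (q i).natDegree) * (q i).comp (X + C (na (e j)))).natDegree := by
          apply natDegree_mul_C_le
      _ ≤ (X ^ (D - (q i).natDegree) : ℂ[X]).natDegree + ((q i).comp (X + C (na (e j)))).natDegree := natDegree_mul_le
      _ ≤ D := by
        rw [natDegree_X_pow, natDegree_comp, natDegree_X_add_C]; omega
  have hcoef : ∀ i j, (M i j).coeff D = (q i).leadingCoeff * wa (e j) ^ ((i : Fin L) : ℕ) := by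
    intro i j
    have h1 := hdeg i
    simp only [M, Matrix.of_apply, coeff_mul_C]
    congr 1
    have h2 : D = (q i).natDegree + (D - (q i).natDegree) := by omega
    rw [mul_comm]
    conv_lhs => rw [h2]
    simp only [Nat.add_sub_cancel_left]
    rw [coeff_mul_X_pow]
    have := natDegree_comp (p := q i) (q := X + C (na (e j)))
    rw [natDegree_X_add_C, mul_one] at this
    conv_lhs => rw [← this]
    rw [coeff_natDegree, leadingCoeff_comp (by simp)]
    simp
  have hdetdeg : M.det.natDegree ≤ Fintype.card S * D := by
    rw [Matrix.det_apply]
    apply natDegree_sum_le_of_forall_le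
    intro σ _
    refine (natDegree_smul_le _ _).trans ?_
    refine (natDegree_prod_le _ _).trans ?_
    calc _ ≤ ∑ i : S, D := Finset.sum_le_sum (fun i _ => hentry _ _)
      _ = _ := by simp
  have hdetcoef : M.det.coeff (Fintype.card S * D) ≠ 0 := by
    have : M.det.coeff (Fintype.card S * D) = (∏ i : S, (q i).leadingCoeff) *
        (Matrix.of fun (i j : S) => (wa (e j)) ^ ((i : Fin L) : ℕ)).det := by
      rw [← Matrix.det_mul_column, Matrix.det_apply, Matrix.det_apply, finsetSum_coeff]
      apply Finset.sum_congr rfl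
      intro σ _
      rw [Units.smul_def, Units.smul_def, coeff_smul]
      congr 1
      have := coeff_prod_of_natDegree_le (s := Finset.univ) (f := fun i => M (σ i) i) D (fun i _ => hentry _ _)
      rw [Finset.card_univ] at this
      rw [this]
      apply Finset.prod_congr rfl
      intro i _
      rw [hcoef]
      rfl
    rw [this]
    refine mul_ne_zero (Finset.prod_ne_zero_iff.mpr fun i _ => ?_) he
    exact leadingCoeff_ne_zero.mpr i.2
  have hroots : ∀ b ∈ B, M.det.eval (nb b) = 0 := by
    intro b hb
    rw [← coe_evalRingHom, RingHom.map_det]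
    have hM : (evalRingHom (nb b)).mapMatrix M = Matrix.of fun i j : S =>
        (nb b ^ (D - (q i).natDegree)) * (Matrix.of (fun i j : S =>
          (q i).eval (nb b + na (e j)) * wa (e j) ^ ((i : Fin L) : ℕ))) i j := by
      ext i j
      simp [M, mul_assoc]
    rw [hM, Matrix.det_mul_column]
    apply mul_eq_zero_of_right
    apply Matrix.exists_vecMul_eq_zero_iff.mp
    refine ⟨fun i => wb b ^ ((i : Fin L) : ℕ), ?_, ?_⟩
    · intro h0
      have := congrFun h0 ⟨l0, hl0⟩
      exact pow_ne_zero _ (hwb b hb) this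
    · ext j
      simp only [Matrix.vecMul, dotProduct, Matrix.of_apply, Pi.zero_apply]
      rw [hsub (fun l => wb b ^ (l : ℕ) * ((q l).eval (nb b + na (e j)) * wa (e j) ^ (l : ℕ)))
        (fun l hl => by simp [hl]), ← hz (e j) b hb]
      apply Finset.sum_congr rfl
      intro l _
      rw [mul_pow]; ring
  have hle : (B.image nb).card ≤ M.det.natDegree := by
    have h0 : M.det ≠ 0 := by
      intro h; rw [h] at hdetcoef; simp at hdetcoef
    apply Polynomial.card_le_degree_of_subset_roots
    intro z hz'
    simp only [Finset.mem_val, Finset.mem_image] at hz'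
    obtain ⟨b, hb, rfl⟩ := hz'
    exact (mem_roots h0).mpr (hroots b hb)
  rw [Finset.card_image_of_injOn hnb] at hle
  have hS : Fintype.card S ≤ L := by
    simpa only [Fintype.card_fin] using Fintype.card_subtype_le (fun l : Fin L => q l ≠ 0)
  have := Nat.mul_le_mul_right D hS
  omega

theorem taylor_rem (f : ℂ → ℂ) (hf : Differentiable ℂ f) (N : ℕ) :
    ∃ (a : ℕ → ℂ) (g : ℂ → ℂ), Differentiable ℂ g ∧
      ∀ z, f z = ∑ m ∈ Finset.range N, a m * z ^ m + z ^ N * g z := by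
  induction N with
  | zero => exact ⟨0, f, hf, by simp⟩
  | succ N ih =>
    obtain ⟨a, g, hg, h⟩ := ih
    refine ⟨fun m => if m = N then g 0 else a m, dslope g 0, ?_, ?_⟩
    · have := (Complex.differentiableOn_dslope (f := g) (s := Set.univ) (c := 0) Filter.univ_mem).mpr hg.differentiableOn
      exact differentiableOn_univ.mp this
    · intro z
      rw [h z, Finset.sum_range_succ]
      simp only [if_true]
      have h1 : g z = g 0 + z * dslope g 0 z := by
        have := sub_smul_dslope g 0 z
        simp only [sub_zero, smul_eq_mul] at this
        rw [this]; ring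
      have h2 : ∑ m ∈ Finset.range N, (if m = N then g 0 else a m) * z ^ m
          = ∑ m ∈ Finset.range N, a m * z ^ m := by
        apply Finset.sum_congr rfl
        intro m hm
        rw [if_neg (by have := Finset.mem_range.mp hm; omega)]
      rw [h2, h1]; ring

theorem det_norm_le {ι : Type*} [Fintype ι] [DecidableEq ι] (A : Matrix ι ι ℂ) (b : ι → ℝ)
    (h : ∀ i j, ‖A i j‖ ≤ b i) :
    ‖A.det‖ ≤ (Fintype.card ι).factorial * ∏ i, b i := by
  rw [Matrix.det_apply]
  refine (norm_sum_le _ _).trans ?_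
  calc _ ≤ ∑ σ : Equiv.Perm ι, ∏ i, b i := by
        apply Finset.sum_le_sum
        intro σ _
        have h1 : ‖Equiv.Perm.sign σ • ∏ i, A (σ i) i‖ = ∏ i, ‖A (σ i) i‖ := by
          rcases Int.units_eq_one_or (Equiv.Perm.sign σ) with h | h <;> simp [h, norm_prod]
        rw [h1, ← Equiv.prod_comp σ b]
        exact Finset.prod_le_prod (fun i _ => norm_nonneg _) (fun i _ => h _ _)
    _ = _ := by simp [Finset.card_univ, Fintype.card_perm]

theorem schwarz (h : ℂ → ℂ) (hd : Differentiable ℂ h) (ρ C : ℝ) (hρ : 1 ≤ ρ)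
    (hb : ∀ x : ℂ, ‖x‖ = ρ → ‖h x‖ ≤ C) : ‖h 1‖ ≤ C := by
  apply Complex.norm_le_of_forall_mem_frontier_norm_le (U := Metric.ball 0 ρ)
    Metric.isBounded_ball hd.diffContOnCl
  · intro z hz
    rw [frontier_ball _ (by linarith)] at hz
    exact hb z (by simpa using hz)
  · rw [closure_ball _ (by linarith)]
    simpa using hρ

theorem interp_fin (N : ℕ) (f : Fin N → ℂ → ℂ) (hf : ∀ i, Differentiable ℂ (f i))
    (n : Fin N → ℂ) (hn : Function.Injective n) (B : Fin N → Fin N → ℂ) (ρ : ℝ) (hρ : 1 ≤ ρ)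
    (b : Fin N → ℝ)
    (hb : ∀ x : ℂ, ‖x‖ = ρ → ∀ i j, ‖f i (x * n j)‖ + ρ ^ N * ‖B i j‖ ≤ b i) :
    ‖(Matrix.of fun i j => f i (n j) + B i j).det‖ * ρ ^ (∑ i : Fin N, (i : ℕ)) ≤
      N.factorial * ∏ i, b i := by
  choose a g hg hfg using fun i => taylor_rem (f i) (hf i) N
  let V : Matrix (Fin N) (Fin N) ℂ := Matrix.of fun m j => n j ^ (m : ℕ)
  have hV : V.det ≠ 0 := by
    have : V = (Matrix.vandermonde n).transpose := by ext; simp [V, Matrix.vandermonde]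
    rw [this, Matrix.det_transpose]
    exact Matrix.det_vandermonde_ne_zero_iff.mpr hn
  have hVu : IsUnit V.det := isUnit_iff_ne_zero.mpr hV
  let E : ℂ → Matrix (Fin N) (Fin N) ℂ := fun x => Matrix.of fun i j => n j ^ N * g i (x * n j) + B i j
  let P : Matrix (Fin N) (Fin N) ℂ := Matrix.of fun i m => a i m
  let G : ℂ → Matrix (Fin N) (Fin N) ℂ := fun x =>
    P + (E x * V⁻¹) * Matrix.diagonal (fun m : Fin N => x ^ (N - (m : ℕ)))
  let F : ℂ → Matrix (Fin N) (Fin N) ℂ := fun x => Matrix.of fun i j => f i (x * n j) + x ^ N * B i j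
  have hF : ∀ x, F x = G x * Matrix.diagonal (fun m : Fin N => x ^ (m : ℕ)) * V := by
    intro x
    have h1 : Matrix.diagonal (fun m : Fin N => x ^ (N - (m : ℕ))) *
        Matrix.diagonal (fun m : Fin N => x ^ (m : ℕ)) = x ^ N • (1 : Matrix (Fin N) (Fin N) ℂ) := by
      rw [Matrix.diagonal_mul_diagonal, Matrix.smul_one_eq_diagonal]
      congr 1
      ext m
      rw [← pow_add]; congr 1; omega
    simp only [G]
    rw [add_mul, add_mul, mul_assoc (E x * V⁻¹), h1, mul_smul_comm, mul_one, smul_mul_assoc,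
      mul_assoc (E x), Matrix.nonsing_inv_mul _ hVu, mul_one]
    ext i j
    simp only [F, Matrix.of_apply, Matrix.add_apply, Matrix.smul_apply, E, smul_eq_mul]
    rw [Matrix.mul_apply]
    simp only [Matrix.mul_diagonal, P, V, Matrix.of_apply]
    rw [hfg i, ← Fin.sum_univ_eq_sum_range (fun m => a i m * (x * n j) ^ m)]
    simp only [mul_pow]
    have : ∀ m : Fin N, a i m * (x ^ (m:ℕ) * n j ^ (m:ℕ)) = a i m * x ^ (m:ℕ) * n j ^ (m:ℕ) := fun m => by ring
    simp only [this]
    ring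
  have hdet : ∀ x, (F x).det = ((G x).det * V.det) * x ^ (∑ i : Fin N, (i : ℕ)) := by
    intro x
    rw [hF, Matrix.det_mul, Matrix.det_mul, Matrix.det_diagonal, Finset.prod_pow_eq_pow_sum]
    ring
  have hdiff : Differentiable ℂ (fun x => (G x).det * V.det) := by
    have hG : ∀ i j, Differentiable ℂ (fun x => G x i j) := by
      intro i j
      simp only [G, Matrix.add_apply, Matrix.mul_diagonal]
      simp only [Matrix.mul_apply, E, Matrix.of_apply]
      have := hg
      fun_prop
    simp only [Matrix.det_apply]
    fun_prop
  have h1 : (Matrix.of fun i j => f i (n j) + B i j).det = (G 1).det * V.det := by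
    have := hdet 1
    simp only [F, one_mul, one_pow, mul_one] at this
    exact this
  have hρ0 : 0 < ρ := by linarith
  rw [h1, ← le_div_iff₀ (by positivity)]
  apply schwarz _ hdiff ρ _ hρ
  intro x hx
  rw [le_div_iff₀ (by positivity)]
  have h2 := congrArg norm (hdet x)
  rw [norm_mul _ (x ^ _), norm_pow, hx] at h2
  rw [← h2]
  have := det_norm_le (F x) b (fun i j => by
    refine le_trans ?_ (hb x hx i j)
    simp only [F, Matrix.of_apply]
    refine (norm_add_le _ _).trans ?_
    rw [norm_mul, norm_pow, hx])
  simpa using this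

theorem interp {ι : Type*} [Fintype ι] [DecidableEq ι] (N : ℕ) (hN : Fintype.card ι = N)
    (f : ι → ℂ → ℂ) (hf : ∀ i, Differentiable ℂ (f i))
    (n : ι → ℂ) (hn : Function.Injective n) (B : ι → ι → ℂ) (ρ : ℝ) (hρ : 1 ≤ ρ)
    (b : ι → ℝ)
    (hb : ∀ x : ℂ, ‖x‖ = ρ → ∀ i j, ‖f i (x * n j)‖ + ρ ^ N * ‖B i j‖ ≤ b i) :
    ‖(Matrix.of fun i j => f i (n j) + B i j).det‖ * ρ ^ (N * (N - 1) / 2) ≤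
      N.factorial * ∏ i, b i := by
  let e : Fin N ≃ ι := (Fintype.equivFinOfCardEq hN).symm
  have := interp_fin N (f ∘ e) (fun i => hf _) (n ∘ e) (hn.comp e.injective)
    (fun i j => B (e i) (e j)) ρ hρ (b ∘ e) (fun x hx i j => hb x hx _ _)
  rw [Fin.sum_univ_eq_sum_range (fun i => i), Finset.sum_range_id] at this
  have h2 : (∏ i, (b ∘ e) i) = ∏ i, b i := Equiv.prod_comp e b
  rw [h2] at this
  rw [← Matrix.det_submatrix_equiv_self e]
  exact this
noncomputable def bp (j : ℕ) : ℂ[X] := C ((j.factorial : ℂ)⁻¹) * descPochhammer ℂ j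

theorem bp_eval (j : ℕ) (z : ℂ) :
    (bp j).eval z = (∏ i ∈ Finset.range j, (z - i)) / j.factorial := by
  rw [bp, eval_mul, eval_C, descPochhammer_eval_eq_prod_range, div_eq_inv_mul]

theorem bp_natDegree (j : ℕ) : (bp j).natDegree ≤ j := by
  refine (natDegree_C_mul_le _ _).trans ?_
  rw [descPochhammer_natDegree]

theorem bp_eval_int (j : ℕ) (n : ℤ) : (bp j).eval (n : ℂ) = ((Ring.choose n j : ℤ) : ℂ) := by
  have h := Ring.descPochhammer_eq_factorial_smul_choose n j
  have h2 : (descPochhammer ℂ j).eval (n : ℂ) = ((j.factorial * Ring.choose n j : ℤ) : ℂ) := by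
    rw [nsmul_eq_mul] at h
    rw [← h, ← Polynomial.eval_eq_smeval, descPochhammer_eval_eq_prod_range,
      descPochhammer_eval_eq_prod_range]
    push_cast
    rfl
  rw [bp, eval_mul, eval_C, h2]
  push_cast
  rw [inv_mul_cancel_left₀]
  exact_mod_cast j.factorial_ne_zero

theorem bp_bound (j K : ℕ) (hj : j ≤ K) (z : ℂ) (r : ℝ) (hz : ‖z‖ ≤ r) :
    ‖(bp j).eval z‖ ≤ (r + K) ^ j / j.factorial := by
  rw [bp_eval, norm_div, norm_prod, Complex.norm_natCast]
  gcongr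
  calc _ ≤ ∏ i ∈ Finset.range j, (r + K) := by
        apply Finset.prod_le_prod (fun i _ => norm_nonneg _)
        intro i hi
        refine (norm_sub_le _ _).trans ?_
        rw [Complex.norm_natCast]
        have : (i : ℝ) ≤ K := by
          have := Finset.mem_range.mp hi
          exact_mod_cast (by omega : i ≤ K)
        linarith
    _ = _ := by simp

theorem bp_indep (K : ℕ) (c : Fin K → ℂ) (h : ∑ j : Fin K, C (c j) * bp j = 0) : c = 0 := by
  have key : ∀ m : ℕ, ∀ hm : m < K, c ⟨m, hm⟩ = 0 := by
    intro m
    induction m using Nat.strong_induction_on with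
    | _ m ih =>
      intro hm
      have h1 := congrArg (eval (m : ℂ)) h
      rw [eval_finsetSum, eval_zero, Finset.sum_eq_single ⟨m, hm⟩] at h1
      · have h2 : (bp m).eval (m : ℂ) = 1 := by
          have := bp_eval_int m m
          simp only [Int.cast_natCast, Ring.choose_natCast, Nat.choose_self] at this
          simpa using this
        simpa [h2] using h1
      · intro j _ hj
        rw [eval_mul, eval_C]
        rcases lt_trichotomy j.1 m with hlt | heq | hgt
        · rw [ih j.1 hlt j.2, zero_mul]
        · exact absurd (Fin.ext heq) hj
        · have := bp_eval_int j m
          simp only [Int.cast_natCast, Ring.choose_natCast, Nat.choose_eq_zero_of_lt hgt] at this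
          rw [this]; simp
      · simp
  ext j
  exact key j.1 j.2
theorem node_inj (p R : ℕ) (hp : p.Prime) (k : ℤ) (hk0 : k ≠ 0) (hkp : 2 * |k| ≤ p) (hR : 2 * R < p)
    (r s r' s' : ℤ) (hr : |r| ≤ R) (hr' : |r'| ≤ R) (h : k * r + p * s = k * r' + p * s') :
    r = r' ∧ s = s' := by
  have hp' : Prime (p : ℤ) := Nat.prime_iff_prime_int.mp hp
  have hp0 : (0 : ℤ) < p := by exact_mod_cast hp.pos
  have hd : (p : ℤ) ∣ k * (r - r') := ⟨s' - s, by linarith⟩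
  have hkd : ¬ (p : ℤ) ∣ k := by
    intro hd
    have := Int.le_of_dvd (abs_pos.mpr hk0) ((dvd_abs _ _).mpr hd)
    have := abs_pos.mpr hk0
    omega
  have hrd := (hp'.dvd_or_dvd hd).resolve_left hkd
  have hrr : r = r' := by
    by_contra hne
    have h1 := Int.le_of_dvd (abs_pos.mpr (sub_ne_zero.mpr hne)) ((dvd_abs _ _).mpr hrd)
    have h2 := abs_sub r r'
    omega
  subst hrr
  refine ⟨rfl, ?_⟩
  have : (p : ℤ) * s = p * s' := by linarith
  exact mul_left_cancel₀ hp0.ne' this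

theorem exists_det (p K R S : ℕ) (hp : p.Prime) (k : ℤ) (hk0 : k ≠ 0) (hkp : 2 * |k| ≤ p)
    (hR : 2 * R < p) (hR1 : 1 ≤ R) (hS : 2 ≤ S) (g : ℂ) (hg0 : g ≠ 0)
    (hg : ∀ s : ℕ, g ≠ Complex.I ^ s)
    (hK : 7 * (K - 1) < 2 * R * (2 * S - 2)) :
    ∃ e : Fin K × Fin 7 → ℤ × ℤ, (∀ i, |(e i).1| ≤ R ∧ |(e i).2| ≤ S) ∧
      (Matrix.of fun (i c : Fin K × Fin 7) =>
        (bp i.1).eval (((k * (e c).1 + p * (e c).2 : ℤ)) : ℂ) *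
          (g ^ (e c).1 * Complex.I ^ (e c).2) ^ ((i.2 : ℤ) - 3)).det ≠ 0 := by
  classical
  let P := {x : ℤ × ℤ // |x.1| ≤ R ∧ |x.2| ≤ S}
  let n : ℤ × ℤ → ℂ := fun x => ((k * x.1 + p * x.2 : ℤ) : ℂ)
  let w : ℤ × ℤ → ℂ := fun x => g ^ x.1 * Complex.I ^ x.2
  have hw0 : ∀ x, w x ≠ 0 := fun x => mul_ne_zero (zpow_ne_zero _ hg0) (zpow_ne_zero _ Complex.I_ne_zero)
  obtain ⟨e, he⟩ := exists_minor (fun (i : Fin K × Fin 7) (x : P) =>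
      (bp i.1).eval (n x.1) * (w x.1) ^ ((i.2 : ℤ) - 3)) (by
    intro c hc
    let q : Fin 7 → ℂ[X] := fun l => ∑ j : Fin K, C (c (j, l)) * bp j
    let pa : Fin 7 → ℤ × ℤ := fun a => ((a / 4 : ℕ), (a % 4 : ℕ))
    let B : Finset (ℤ × ℤ) := Finset.Ico (-(R:ℤ)) R ×ˢ Finset.Icc (-(S:ℤ)) (S - 3)
    have hq := zero_estimate (K - 1) q (by
        intro l
        apply natDegree_sum_le_of_forall_le
        intro j _
        refine (natDegree_C_mul_le _ _).trans ((bp_natDegree _).trans ?_)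
        have := j.2; omega)
      (fun a => n (pa a)) (fun a => w (pa a)) (by
        have hI : ∀ a b : ℕ, a < 4 → b < 4 → Complex.I ^ a = Complex.I ^ b → a = b := by
          intro a b ha hb h
          have h1 := congrArg Complex.re h
          have h2 := congrArg Complex.im h
          clear h
          interval_cases a <;> interval_cases b <;>
            first | rfl | (exfalso; revert h1 h2; norm_num [pow_succ])
        have hgI : ∀ a b : ℕ, a < 4 → b < 4 → g * Complex.I ^ a ≠ Complex.I ^ b := by
          intro a b ha hb h
          apply hg (b + (4 - a))
          have : Complex.I ^ 4 = 1 := Complex.I_pow_four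
          rw [pow_add, ← h, mul_assoc, ← pow_add, show a + (4 - a) = 4 by omega, this, mul_one]
        intro a b hab
        simp only [w, pa, zpow_natCast] at hab
        have ha := a.2
        have hb := b.2
        have ha4 := Nat.mod_lt a.1 (show 0 < 4 by norm_num)
        have hb4 := Nat.mod_lt b.1 (show 0 < 4 by norm_num)
        have ha' : (a:ℕ) / 4 = 0 ∨ (a:ℕ)/4 = 1 := by omega
        have hb' : (b:ℕ) / 4 = 0 ∨ (b:ℕ)/4 = 1 := by omega
        apply Fin.ext
        rcases ha' with h1 | h1 <;> rcases hb' with h2 | h2 <;>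
          rw [h1, h2] at hab <;> simp only [pow_zero, pow_one, one_mul] at hab
        · have := hI _ _ ha4 hb4 hab; omega
        · exact absurd hab.symm (hgI _ _ hb4 ha4)
        · exact absurd hab (hgI _ _ ha4 hb4)
        · have := hI _ _ ha4 hb4 (mul_left_cancel₀ hg0 hab); omega)
      B n w (by
        intro x hx x' hx' h
        simp only [B, Finset.coe_product, Set.mem_prod, Finset.mem_coe, Finset.mem_Ico] at hx hx'
        have h' : k * x.1 + p * x.2 = k * x'.1 + p * x'.2 := by
          simp only [n] at h; exact_mod_cast h
        have := node_inj p R hp k hk0 hkp hR _ _ _ _ (abs_le.mpr ⟨hx.1.1, hx.1.2.le⟩)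
          (abs_le.mpr ⟨hx'.1.1, hx'.1.2.le⟩) h'
        exact Prod.ext this.1 this.2)
      (fun b _ => hw0 b) (by
        simp only [B, Finset.card_product, Int.card_Ico, Int.card_Icc]
        have h1 : ((R:ℤ) - -R).toNat = 2 * R := by omega
        have h2 : ((S:ℤ) - 3 + 1 - -S).toNat = 2 * S - 2 := by omega
        rw [h1, h2]; exact hK)
      (by
        intro a b hb
        simp only [B, Finset.mem_product, Finset.mem_Ico, Finset.mem_Icc] at hb
        have ha := a.2
        let x : P := ⟨(b.1 + (pa a).1, b.2 + (pa a).2), by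
          simp only [pa, abs_le]; omega⟩
        have hnx : n x.1 = n b + n (pa a) := by
          simp only [n, x]; push_cast; ring
        have hwx : w x.1 = w (pa a) * w b := by
          simp only [w, x]
          rw [zpow_add₀ hg0, zpow_add₀ Complex.I_ne_zero]; ring
        have h1 := hc x
        rw [← hnx, ← hwx]
        rw [Fintype.sum_prod_type, Finset.sum_comm] at h1
        calc _ = (w x.1) ^ (3:ℤ) * ∑ l : Fin 7, ∑ j : Fin K, c (j, l) * ((bp j).eval (n x.1) * w x.1 ^ ((l:ℤ) - 3)) := by
              rw [Finset.mul_sum]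
              apply Finset.sum_congr rfl
              intro l _
              simp only [q, eval_finsetSum, eval_mul, eval_C]
              rw [Finset.sum_mul, Finset.mul_sum]
              apply Finset.sum_congr rfl
              intro j _
              rw [zpow_sub₀ (hw0 _), zpow_natCast]
              have := zpow_ne_zero 3 (hw0 x.1)
              field_simp
              rw [mul_div_assoc, div_self (hw0 _), mul_one]
          _ = 0 := by rw [h1, mul_zero])
    ext ⟨j, l⟩
    exact congrFun (bp_indep K (fun j => c (j, l)) (hq l)) j)
  exact ⟨fun i => (e i).1, fun i => (e i).2, he⟩
theorem gauss_norm_ge (z : ℂ) (hz : z ∈ GaussianInt.toComplex.range) (h0 : z ≠ 0) : 1 ≤ ‖z‖ := by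
  obtain ⟨a, rfl⟩ := hz
  have ha : a ≠ 0 := by rintro rfl; simp at h0
  have h1 : (1:ℤ) ≤ a.norm := by
    have := GaussianInt.norm_pos.mpr ha
    omega
  have h2 : ((a.norm : ℤ) : ℝ) = Complex.normSq (GaussianInt.toComplex a) := GaussianInt.intCast_real_norm a
  rw [Complex.normSq_eq_norm_sq] at h2
  have h3 : (1:ℝ) ≤ ‖GaussianInt.toComplex a‖ ^ 2 := by rw [← h2]; exact_mod_cast h1
  nlinarith [norm_nonneg (GaussianInt.toComplex a)]

theorem gauss_I : Complex.I ∈ GaussianInt.toComplex.range :=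
  ⟨⟨0, 1⟩, by rw [GaussianInt.toComplex_def']; simp⟩

theorem gauss_I_zpow (s : ℤ) : Complex.I ^ s ∈ GaussianInt.toComplex.range := by
  obtain ⟨n, rfl | rfl⟩ := Int.eq_nat_or_neg s
  · rw [zpow_natCast]; exact pow_mem gauss_I n
  · rw [zpow_neg, zpow_natCast, ← inv_pow, Complex.inv_I]
    exact pow_mem (neg_mem gauss_I) n

theorem gauss_pow (y : ℕ) (g : ℂ) (h1 : (y : ℂ) * g ∈ GaussianInt.toComplex.range)
    (h2 : (y : ℂ) * g⁻¹ ∈ GaussianInt.toComplex.range) (M : ℕ) (e : ℤ) (he : |e| ≤ M) :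
    (y : ℂ) ^ M * g ^ e ∈ GaussianInt.toComplex.range := by
  have hy : (y : ℂ) ∈ GaussianInt.toComplex.range := natCast_mem _ y
  obtain ⟨n, rfl | rfl⟩ := Int.eq_nat_or_neg e
  · have hn : n ≤ M := by simpa using he
    obtain ⟨d, rfl⟩ := Nat.exists_eq_add_of_le hn
    rw [zpow_natCast, pow_add, mul_right_comm, ← mul_pow]
    exact mul_mem (pow_mem h1 n) (pow_mem hy d)
  · have hn : n ≤ M := by simpa using he
    obtain ⟨d, rfl⟩ := Nat.exists_eq_add_of_le hn
    rw [zpow_neg, zpow_natCast, ← inv_pow, pow_add, mul_right_comm, ← mul_pow]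
    exact mul_mem (pow_mem h2 n) (pow_mem hy d)

theorem core (p K R S : ℕ) (hp : p.Prime) (k : ℤ) (hk0 : k ≠ 0) (hkp : 2 * |k| ≤ p)
    (hR : 3 * R ≤ p) (hR1 : 1 ≤ R) (hS : 2 ≤ S) (g : ℂ) (θ lam : ℝ)
    (hgθ : g = Complex.exp (Complex.I * θ)) (hk : p * θ = k * (Real.pi / 2) + lam)
    (hg : ∀ s : ℕ, g ≠ Complex.I ^ s)
    (hK : 7 * (K - 1) < 2 * R * (2 * S - 2))
    (y : ℕ) (hy1 : (y : ℂ) * g ∈ GaussianInt.toComplex.range)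
    (hy2 : (y : ℂ) * g⁻¹ ∈ GaussianInt.toComplex.range) (hy : 1 ≤ y)
    (ρ : ℝ) (hρ : 1 ≤ ρ) (hlam : |lam| * ρ ^ (7 * K) ≤ 1) (T : ℝ) (hT : T = R / 2 + S) :
    ρ ^ (7 * K * (7 * K - 1) / 2) ≤ (7 * K).factorial *
      ∏ i : Fin K × Fin 7, (2 * ((ρ * (p * T) + K) ^ (i.1 : ℕ) / (i.1 : ℕ).factorial) *
        Real.exp (((i.2 : ℤ) - 3).natAbs * (Real.pi / 2 * ρ * T)) *
          (y : ℝ) ^ (((i.2 : ℤ) - 3).natAbs * R)) := by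
  have hp0 : 0 < p := hp.pos
  have hp0' : (0:ℝ) < p := by exact_mod_cast hp0
  have hg0 : g ≠ 0 := by rw [hgθ]; exact Complex.exp_ne_zero _
  obtain ⟨e, he, hdet⟩ := exists_det p K R S hp k hk0 hkp (by omega) hR1 hS g hg0 hg hK
  set N := 7 * K with hN
  have hcard : Fintype.card (Fin K × Fin 7) = N := by simp [hN, mul_comm]
  let n : Fin K × Fin 7 → ℤ := fun c => k * (e c).1 + p * (e c).2
  have hnb : ∀ c, |(n c : ℝ)| ≤ p * T := by
    intro c
    have h1 := (he c).1
    have h2 := (he c).2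
    have h3 : |n c| ≤ |k| * R + p * S := by
      calc |n c| ≤ |k * (e c).1| + |p * (e c).2| := abs_add_le _ _
        _ = |k| * |(e c).1| + p * |(e c).2| := by rw [abs_mul, abs_mul, Nat.abs_cast]
        _ ≤ _ := by gcongr
    have h4 : (|n c| : ℝ) ≤ |(k:ℝ)| * R + p * S := by exact_mod_cast h3
    have h5 : 2 * |(k:ℝ)| ≤ p := by exact_mod_cast hkp
    rw [hT]
    have : |(k:ℝ)| * R ≤ p / 2 * R := by gcongr; linarith
    linarith
  have hT0 : 0 ≤ T := by rw [hT]; positivity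
  have hninj : Function.Injective (fun c => (n c : ℂ)) := by
    intro c c' h
    by_contra hne
    apply hdet
    have h' : n c = n c' := by
      have : (n c : ℂ) = n c' := h
      exact_mod_cast this
    have h2 := node_inj p R hp k hk0 hkp (by omega) _ _ _ _ (he c).1 (he c').1 h'
    apply Matrix.det_zero_of_column_eq hne
    intro i
    simp only [Matrix.of_apply]
    rw [h2.1, h2.2]
  let f : Fin K × Fin 7 → ℂ → ℂ := fun i z =>
    (bp i.1).eval z * Complex.exp (Complex.I * (((((i.2:ℤ) - 3 : ℤ) : ℝ) * (Real.pi / (2 * p)) : ℝ) : ℂ) * z)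
  let B : Fin K × Fin 7 → Fin K × Fin 7 → ℂ := fun i c => f i (n c) *
    (Complex.exp (Complex.I * (((((i.2:ℤ) - 3 : ℤ) : ℝ) * ((e c).1 * lam / p) : ℝ) : ℂ)) - 1)
  let b : Fin K × Fin 7 → ℝ := fun i => 2 * ((ρ * (p * T) + K) ^ (i.1 : ℕ) / (i.1 : ℕ).factorial) *
        Real.exp (((i.2 : ℤ) - 3).natAbs * (Real.pi / 2 * ρ * T))
  have hA : (Matrix.of fun (i c : Fin K × Fin 7) =>
        (bp i.1).eval (((k * (e c).1 + p * (e c).2 : ℤ)) : ℂ) *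
          (g ^ (e c).1 * Complex.I ^ (e c).2) ^ ((i.2 : ℤ) - 3)) =
      Matrix.of fun i c => f i (n c) + B i c := by
    ext i c
    simp only [Matrix.of_apply, B]
    rw [mul_sub, mul_one, add_sub_cancel]
    simp only [f]
    rw [mul_assoc]
    congr 1
    have hI : Complex.I = Complex.exp (Complex.I * ((Real.pi / 2 : ℝ) : ℂ)) := by
      push_cast
      rw [mul_comm, Complex.exp_pi_div_two_mul_I]
    have hw : g ^ (e c).1 * Complex.I ^ (e c).2 =
        Complex.exp (Complex.I * (((Real.pi / (2 * p)) * n c + (e c).1 * lam / p : ℝ) : ℂ)) := by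
      conv_lhs => rw [hgθ]
      conv_lhs => enter [2, 1]; rw [hI]
      rw [← Complex.exp_int_mul, ← Complex.exp_int_mul, ← Complex.exp_add]
      congr 1
      have h1 : θ = (k * (Real.pi / 2) + lam) / p := by rw [← hk]; field_simp
      have h2 : (Real.pi / (2 * p)) * n c + (e c).1 * lam / p = (e c).1 * θ + (e c).2 * (Real.pi / 2) := by
        rw [h1]; simp only [n]; push_cast; field_simp; ring
      rw [h2]; push_cast; ring
    rw [hw, ← Complex.exp_int_mul, ← Complex.exp_add]
    congr 1
    push_cast
    ring
  have hml : ∀ l : Fin 7, |((((l:ℤ) - 3 : ℤ)) : ℝ)| = (((l:ℤ) - 3).natAbs : ℝ) := by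
    intro l
    rw [Nat.cast_natAbs, Int.cast_abs]
  have hfb : ∀ i, ∀ z : ℂ, ∀ s : ℝ, s ≤ ρ → ‖z‖ ≤ s * (p * T) →
      ‖f i z‖ ≤ b i / 2 := by
    intro i z s hs hz
    have hz' : ‖z‖ ≤ ρ * (p * T) := hz.trans (by gcongr)
    simp only [f, b, norm_mul]
    have h1 := bp_bound i.1 K i.1.2.le z _ hz'
    have h2 : ‖Complex.exp (Complex.I * (((((i.2:ℤ) - 3 : ℤ) : ℝ) * (Real.pi / (2 * p)) : ℝ) : ℂ) * z)‖ ≤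
        Real.exp (((i.2 : ℤ) - 3).natAbs * (Real.pi / 2 * ρ * T)) := by
      refine (Complex.norm_exp_le_exp_norm _).trans ?_
      apply Real.exp_le_exp.mpr
      rw [norm_mul, norm_mul, Complex.norm_I, one_mul, Complex.norm_real, Real.norm_eq_abs, abs_mul,
        hml, abs_of_nonneg (by positivity : 0 ≤ Real.pi / (2 * p))]
      calc _ ≤ (((i.2 : ℤ) - 3).natAbs : ℝ) * (Real.pi / (2 * p)) * (ρ * (p * T)) := by gcongr
        _ = _ := by field_simp
    calc _ ≤ _ := mul_le_mul h1 h2 (norm_nonneg _) (by positivity)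
      _ = _ := by ring
  have hint := interp N hcard f (fun i => by simp only [f]; fun_prop) (fun c => (n c : ℂ)) hninj B ρ hρ b (by
    intro x hx i c
    have h1 : ‖f i (x * n c)‖ ≤ b i / 2 := by
      apply hfb i _ ρ le_rfl
      rw [norm_mul, hx]
      have := hnb c
      rw [Complex.norm_intCast]
      gcongr
    have h2 : ‖f i (n c)‖ ≤ b i / 2 := by
      apply hfb i _ 1 hρ
      rw [Complex.norm_intCast, one_mul]
      exact hnb c
    have h3 : ‖(Complex.exp (Complex.I * (((((i.2:ℤ) - 3 : ℤ) : ℝ) * ((e c).1 * lam / p) : ℝ) : ℂ)) - 1)‖ ≤ |lam| := by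
      refine Real.norm_exp_I_mul_ofReal_sub_one_le.trans ?_
      rw [Real.norm_eq_abs, abs_mul, hml, abs_div, abs_mul, Nat.abs_cast]
      have h4 : (((i.2 : ℤ) - 3).natAbs : ℝ) ≤ 3 := by
        have := i.2.2
        exact_mod_cast (by omega : ((i.2 : ℤ) - 3).natAbs ≤ 3)
      have h5 : |((e c).1 : ℝ)| ≤ R := by exact_mod_cast (he c).1
      have h6 : 3 * (R:ℝ) ≤ p := by exact_mod_cast hR
      calc _ ≤ 3 * (R * |lam| / p) := by gcongr
        _ = (3 * R) / p * |lam| := by ring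
        _ ≤ 1 * |lam| := by gcongr; rw [div_le_one hp0']; exact h6
        _ = _ := one_mul _
    have h7 : ρ ^ N * ‖B i c‖ ≤ b i / 2 := by
      simp only [B, norm_mul]
      have hb0 : 0 ≤ b i / 2 := (norm_nonneg _).trans h2
      calc _ ≤ ρ ^ N * (b i / 2 * |lam|) := by gcongr
        _ = b i / 2 * (|lam| * ρ ^ N) := by ring
        _ ≤ b i / 2 * 1 := by gcongr
        _ = _ := mul_one _
    linarith)
  rw [← hA] at hint
  set A := (Matrix.of fun (i c : Fin K × Fin 7) =>
        (bp i.1).eval (((k * (e c).1 + p * (e c).2 : ℤ)) : ℂ) *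
          (g ^ (e c).1 * Complex.I ^ (e c).2) ^ ((i.2 : ℤ) - 3)) with hAdef
  let Y : Fin K × Fin 7 → ℝ := fun i => (y : ℝ) ^ (((i.2 : ℤ) - 3).natAbs * R)
  have hlow : 1 ≤ (∏ i, Y i) * ‖A.det‖ := by
    have h1 : (∏ i, (Y i : ℂ)) * A.det ∈ GaussianInt.toComplex.range := by
      rw [← Matrix.det_mul_column, Matrix.det_apply]
      apply sum_mem
      intro σ _
      rw [Units.smul_def, zsmul_eq_mul]
      apply mul_mem (intCast_mem _ _)
      apply prod_mem
      intro c _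
      simp only [Matrix.of_apply, hAdef, Y]
      rw [bp_eval_int, mul_zpow, ← zpow_mul, ← zpow_mul]
      have h2 := gauss_pow y g hy1 hy2 ((((σ c).2 : ℤ) - 3).natAbs * R) ((e c).1 * (((σ c).2 : ℤ) - 3)) (by
        rw [abs_mul]
        push_cast
        rw [mul_comm]
        have := (he c).1
        gcongr)
      have h3 := gauss_I_zpow ((e c).2 * (((σ c).2 : ℤ) - 3))
      have h4 : ((Ring.choose (k * (e c).1 + p * (e c).2) ((σ c).1 : ℕ) : ℤ) : ℂ) ∈ GaussianInt.toComplex.range :=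
        intCast_mem _ _
      convert mul_mem h4 (mul_mem h2 h3) using 1
      push_cast
      ring
    have hY0 : ∀ i, (Y i : ℂ) ≠ 0 := by
      intro i
      have : (0:ℝ) < y := by exact_mod_cast hy
      have : 0 < Y i := by simp only [Y]; positivity
      exact_mod_cast this.ne'
    have h2 := gauss_norm_ge _ h1 (mul_ne_zero (Finset.prod_ne_zero_iff.mpr fun i _ => hY0 i) hdet)
    rw [norm_mul, norm_prod] at h2
    have h3 : ∀ i, ‖(Y i : ℂ)‖ = Y i := by
      intro i
      rw [Complex.norm_real, Real.norm_of_nonneg (by simp only [Y]; positivity)]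
    simpa only [h3] using h2
  have hYp : 0 ≤ ∏ i, Y i := Finset.prod_nonneg (fun i _ => by simp only [Y]; positivity)
  calc ρ ^ (N * (N - 1) / 2) ≤ ρ ^ (N * (N - 1) / 2) * ((∏ i, Y i) * ‖A.det‖) :=
        le_mul_of_one_le_right (by positivity) hlow
    _ = (‖A.det‖ * ρ ^ (N * (N - 1) / 2)) * ∏ i, Y i := by ring
    _ ≤ (N.factorial * ∏ i, b i) * ∏ i, Y i := by gcongr
    _ = N.factorial * ∏ i, (b i * Y i) := by rw [mul_assoc, ← Finset.prod_mul_distrib]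
theorem log_fact_ge (K : ℕ) (hK : 1 ≤ K) :
    (K : ℝ) * Real.log K - K + 1 / 2 ≤ Real.log (K.factorial) := by
  have h := Stirling.le_log_factorial_stirling (n := K) (by omega)
  have hK' : (1:ℝ) ≤ K := by exact_mod_cast hK
  have h1 : 0 ≤ Real.log K := Real.log_nonneg hK'
  have h2 : 1 ≤ Real.log (2 * Real.pi) := by
    rw [Real.le_log_iff_exp_le (by positivity)]
    have := Real.exp_one_lt_d9
    have := Real.pi_gt_three
    linarith
  linarith

theorem superfact (K : ℕ) (hK : 1 ≤ K) :
    (K : ℝ) * (K - 1) / 2 * (Real.log K - 3 / 2) ≤ ∑ j ∈ Finset.range K, Real.log (j.factorial) := by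
  induction K, hK using Nat.le_induction with
  | base => simp
  | succ K hK ih =>
    rw [Finset.sum_range_succ]
    have h1 := log_fact_ge K hK
    have hK' : (0:ℝ) < K := by exact_mod_cast hK
    have h2 : Real.log (K + 1) ≤ Real.log K + 1 / K := by
      have : (K:ℝ) + 1 = K * (1 + 1 / K) := by field_simp
      rw [this, Real.log_mul (by positivity) (by positivity)]
      have := Real.log_le_sub_one_of_pos (show (0:ℝ) < 1 + 1 / K by positivity)
      linarith
    push_cast
    have h3 : ((K:ℝ) + 1) * (K + 1 - 1) / 2 * (Real.log (K + 1) - 3 / 2) ≤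
        ((K:ℝ) + 1) * (K + 1 - 1) / 2 * (Real.log K + 1 / K - 3 / 2) := by
      apply mul_le_mul_of_nonneg_left (by linarith)
      have : (0:ℝ) ≤ K + 1 - 1 := by linarith
      positivity
    have h4 : ((K:ℝ) + 1) * (K + 1 - 1) / 2 * (Real.log K + 1 / K - 3 / 2) =
        (K : ℝ) * (K - 1) / 2 * (Real.log K - 3 / 2) + (K * Real.log K - K + 1 / 2) := by
      field_simp; ring
    linarith

theorem log_ineq (K R y : ℕ) (ρ Q V : ℝ) (hK : 1 ≤ K) (hρ : 1 ≤ ρ) (hQ : 0 < Q) (hy : 1 ≤ y)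
    (h : ρ ^ (7 * K * (7 * K - 1) / 2) ≤ (7 * K).factorial *
      ∏ i : Fin K × Fin 7, (2 * (Q ^ (i.1 : ℕ) / (i.1 : ℕ).factorial) *
        Real.exp (((i.2 : ℤ) - 3).natAbs * V) *
          (y : ℝ) ^ (((i.2 : ℤ) - 3).natAbs * R))) :
    (7 * (K:ℝ) - 1) / 2 * Real.log ρ ≤ Real.log (7 * K) + Real.log 2 +
      (K - 1) / 2 * (Real.log Q - Real.log K + 3 / 2) + 12 / 7 * V + 12 / 7 * R * Real.log y := by
  have hK' : (1:ℝ) ≤ K := by exact_mod_cast hK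
  have hy' : (0:ℝ) < y := by exact_mod_cast hy
  have hρ0 : 0 < ρ := by linarith
  have h1 := Real.log_le_log (by positivity) h
  have hterm : ∀ i : Fin K × Fin 7, (2 * (Q ^ (i.1 : ℕ) / (i.1 : ℕ).factorial) *
        Real.exp (((i.2 : ℤ) - 3).natAbs * V) *
          (y : ℝ) ^ (((i.2 : ℤ) - 3).natAbs * R)) ≠ 0 := by
    intro i; positivity
  have hlt : ∀ i : Fin K × Fin 7, Real.log (2 * (Q ^ (i.1 : ℕ) / (i.1 : ℕ).factorial) *
        Real.exp (((i.2 : ℤ) - 3).natAbs * V) *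
          (y : ℝ) ^ (((i.2 : ℤ) - 3).natAbs * R)) =
        (Real.log 2 + (i.1 : ℕ) * Real.log Q - Real.log ((i.1:ℕ).factorial)) +
        (((i.2 : ℤ) - 3).natAbs : ℝ) * (V + R * Real.log y) := by
    intro i
    rw [Real.log_mul (by positivity) (by positivity), Real.log_mul (by positivity) (by positivity),
      Real.log_mul (by positivity) (by positivity), Real.log_div (by positivity) (by positivity),
      Real.log_exp, Real.log_pow, Real.log_pow]
    push_cast; ring
  have hm : ∑ l : Fin 7, (((l : ℤ) - 3).natAbs : ℝ) = 12 := by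
    have : ∑ l : Fin 7, ((l : ℤ) - 3).natAbs = 12 := by decide
    exact_mod_cast this
  have hfac : Real.log ((7 * K).factorial) ≤ 7 * K * Real.log (7 * K) := by
    have := Real.log_le_log (by positivity) (show ((7 * K).factorial : ℝ) ≤ ((7 * K : ℕ) : ℝ) ^ (7 * K) by
      exact_mod_cast Nat.factorial_le_pow (7 * K))
    rw [Real.log_pow] at this
    push_cast at this
    exact this
  rw [Real.log_mul (by positivity) (Finset.prod_ne_zero_iff.mpr fun i _ => hterm i), Real.log_pow,
    Real.log_prod (fun i _ => hterm i)] at h1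
  simp only [hlt] at h1
  rw [Fintype.sum_prod_type] at h1
  simp only [Finset.sum_add_distrib, ← Finset.sum_mul, hm] at h1
  simp only [Finset.sum_const, Finset.card_univ, Fintype.card_fin, nsmul_eq_mul, ← Finset.mul_sum,
    Finset.sum_sub_distrib, Finset.sum_add_distrib, ← Finset.sum_mul] at h1
  rw [Fin.sum_univ_eq_sum_range (fun j => (j:ℝ)), Fin.sum_univ_eq_sum_range (fun j => Real.log (j.factorial)),
    ← Nat.cast_sum, Finset.sum_range_id] at h1
  have h2 := superfact K hK
  have c1 : ((7 * K * (7 * K - 1) / 2 : ℕ) : ℝ) = 7 * K * (7 * K - 1) / 2 := by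
    rw [Nat.cast_div ((Nat.even_mul_pred_self _).two_dvd) (by norm_num)]
    rw [Nat.cast_mul, Nat.cast_sub (by omega)]; push_cast; ring
  have c2 : ((K * (K - 1) / 2 : ℕ) : ℝ) = K * (K - 1) / 2 := by
    rw [Nat.cast_div ((Nat.even_mul_pred_self _).two_dvd) (by norm_num)]
    rw [Nat.cast_mul, Nat.cast_sub (by omega)]; push_cast; ring
  rw [c1, c2] at h1
  have h3 : 7 * (K:ℝ) * ((7 * (K:ℝ) - 1) / 2 * Real.log ρ) ≤ 7 * K * (Real.log (7 * K) + Real.log 2 +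
      (K - 1) / 2 * (Real.log Q - Real.log K + 3 / 2) + 12 / 7 * V + 12 / 7 * R * Real.log y) := by
    push_cast at h1
    nlinarith
  exact le_of_mul_le_mul_left h3 (by positivity)

theorem numeric (K R S0 p : ℕ) (ρ Y T : ℝ) (hρ : 79 / 10 ≤ ρ) (hp : (p:ℝ) = ρ ^ 6 / 64)
    (hY : 23 / 2 ≤ Y) (hR1 : 4 * ρ ≤ R) (hS1 : 2 * ρ + 5 / 2 * Y ≤ S0)
    (hT : T = R / 2 + S0 + 1) (hK1 : 1 ≤ K) (hK : 4 * R * S0 ≤ 7 * K)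
    (h : (7 * (K:ℝ) - 1) / 2 * Real.log ρ ≤ Real.log (7 * K) + Real.log 2 +
      (K - 1) / 2 * (Real.log (ρ * (p * T) + K) - Real.log K + 3 / 2) + 12 / 7 * (Real.pi / 2 * ρ * T)
        + 12 / 7 * R * Y) : False := by
  have hK1' : (1:ℝ) ≤ K := by exact_mod_cast hK1
  have hK' : 4 * (R:ℝ) * S0 ≤ 7 * K := by exact_mod_cast hK
  have hρ0 : 0 < ρ := by linarith
  have hR : (31.6:ℝ) ≤ R := by linarith
  have hS : (44.5:ℝ) ≤ S0 := by linarith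
  have hT0 : 0 < T := by rw [hT]; linarith
  have hTK : T ≤ 64 / 760 * K := by
    rw [hT]
    nlinarith [mul_nonneg (sub_nonneg.mpr hR) (sub_nonneg.mpr hS)]
  have hρ7 : (1000000:ℝ) ≤ ρ ^ 7 := by
    calc (1000000:ℝ) ≤ (79 / 10) ^ 7 := by norm_num
      _ ≤ ρ ^ 7 := by gcongr
  have hQ : ρ * (p * T) + K ≤ K * ρ ^ 7 / 750 := by
    rw [hp]
    have : ρ * (ρ ^ 6 / 64 * T) ≤ ρ ^ 7 / 760 * K := by
      calc _ = ρ ^ 7 / 64 * T := by ring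
        _ ≤ ρ ^ 7 / 64 * (64 / 760 * K) := by gcongr
        _ = _ := by ring
    nlinarith
  have hlogρ : 2 ≤ Real.log ρ := by
    rw [Real.le_log_iff_exp_le hρ0]
    have h1 := Real.exp_one_lt_d9
    have h2 : Real.exp 2 = Real.exp 1 ^ 2 := by rw [← Real.exp_nat_mul]; norm_num
    have h3 : Real.exp 1 ^ 2 ≤ (2.7182818286:ℝ) ^ 2 := by gcongr
    norm_num at h3
    linarith
  have h750 : 6.6 ≤ Real.log 750 := by
    rw [Real.le_log_iff_exp_le (by norm_num)]
    have h1 := Real.exp_one_lt_d9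
    have h2 : Real.exp 6.6 ^ 5 = Real.exp 1 ^ 33 := by
      rw [← Real.exp_nat_mul, ← Real.exp_nat_mul]; norm_num
    have h3 : Real.exp 1 ^ 33 ≤ (2.7182818286:ℝ) ^ 33 := by gcongr
    have h4 : (2.7182818286:ℝ) ^ 33 ≤ 750 ^ 5 := by norm_num
    exact le_of_pow_le_pow_left₀ (n := 5) (by norm_num) (by norm_num) (by linarith)
  have hlogQ : Real.log (ρ * (p * T) + K) - Real.log K ≤ 7 * Real.log ρ - 6.6 := by
    have hpos : 0 < ρ * (p * T) + K := by positivity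
    have := Real.log_le_log hpos hQ
    rw [Real.log_div (by positivity) (by norm_num), Real.log_mul (by positivity) (by positivity),
      Real.log_pow] at this
    push_cast at this
    linarith
  have hlogK : Real.log (7 * K) + Real.log 2 ≤ 14 * K / 1000 + 6 := by
    rw [← Real.log_mul (by positivity) (by norm_num)]
    have h1 : Real.log (7 * K * 2) = Real.log (7 * K * 2 / 1000) + Real.log 1000 := by
      rw [← Real.log_mul (by positivity) (by norm_num)]; congr 1; field_simp
    have h2 := Real.log_le_sub_one_of_pos (show (0:ℝ) < 7 * K * 2 / 1000 by positivity)
    have h3 : Real.log 1000 ≤ 7 := by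
      rw [Real.log_le_iff_le_exp (by norm_num)]
      have h1 := Real.exp_one_gt_d9
      have h2 : Real.exp 7 = Real.exp 1 ^ 7 := by rw [← Real.exp_nat_mul]; norm_num
      have h3 : (2.7182818283:ℝ) ^ 7 ≤ Real.exp 1 ^ 7 := by gcongr
      norm_num at h3
      linarith
    linarith
  have h1 : ((K:ℝ) - 1) / 2 * (Real.log (ρ * (p * T) + K) - Real.log K + 3 / 2) ≤
      (K - 1) / 2 * (7 * Real.log ρ - 5.1) := by
    apply mul_le_mul_of_nonneg_left <;> linarith
  have hpi := Real.pi_lt_d4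
  have h2 : 12 / 7 * (Real.pi / 2 * ρ * T) ≤ 2.6931 * (R / 4 * (S0 + 1) + ρ * R / 2) := by
    have hρT : ρ * T ≤ R / 4 * (S0 + 1) + ρ * R / 2 := by
      rw [hT]
      nlinarith
    have : 12 / 7 * (Real.pi / 2 * ρ * T) = 6 / 7 * Real.pi * (ρ * T) := by ring
    rw [this]
    have h0 : 0 ≤ ρ * T := by positivity
    calc _ ≤ 6 / 7 * 3.1416 * (ρ * T) := by gcongr
      _ ≤ 2.6931 * (ρ * T) := by gcongr; norm_num
      _ ≤ _ := by gcongr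
  have h3 : 2.55 * (K - 1) ≤ 14 * K / 1000 + 6 + 2.6931 * (R / 4 * (S0 + 1) + ρ * R / 2) + 12 / 7 * R * Y := by
    linarith
  have hRS : (R:ℝ) * (2 * ρ + 5 / 2 * Y) ≤ R * S0 := by gcongr
  nlinarith [mul_nonneg (by linarith : (0:ℝ) ≤ R - 31.6) (by linarith : (0:ℝ) ≤ ρ - 7.9),
    mul_nonneg (by linarith : (0:ℝ) ≤ R - 31.6) (by linarith : (0:ℝ) ≤ Y - 11.5)]

theorem params (p : ℕ) (hp : p.Prime) (hp1 : 3804 ≤ p) (k : ℤ) (hk0 : k ≠ 0)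
    (hkp : 2 * |k| ≤ p) (g : ℂ) (θ lam : ℝ)
    (hgθ : g = Complex.exp (Complex.I * θ)) (hk : p * θ = k * (Real.pi / 2) + lam)
    (hg : ∀ s : ℕ, g ≠ Complex.I ^ s)
    (y : ℕ) (hy1 : (y : ℂ) * g ∈ GaussianInt.toComplex.range)
    (hy2 : (y : ℂ) * g⁻¹ ∈ GaussianInt.toComplex.range) (hy : 126505 ≤ y)
    (n : ℕ) (hn : p = 2 * n + 1)
    (hlam : |lam| * (y : ℝ) ^ n ≤ Real.pi) : False := by
  have hpR : (3804 : ℝ) ≤ p := by exact_mod_cast hp1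
  have hyR : (126505 : ℝ) ≤ y := by exact_mod_cast hy
  obtain ⟨ρ, hρ0, hρp⟩ : ∃ ρ : ℝ, 0 ≤ ρ ∧ (p : ℝ) = ρ ^ 6 / 64 := by
    refine ⟨2 * (p : ℝ) ^ ((1 : ℝ) / 6), by positivity, ?_⟩
    rw [mul_pow, ← Real.rpow_natCast ((p : ℝ) ^ ((1 : ℝ) / 6)), ← Real.rpow_mul (by positivity)]
    norm_num
  have hρ : 79 / 10 ≤ ρ := by
    by_contra hcon
    push Not at hcon
    have : ρ ^ 6 ≤ (79 / 10) ^ 6 := pow_le_pow_left₀ hρ0 hcon.le 6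
    norm_num at this
    linarith
  set Y := Real.log y with hYdef
  have hY : 23 / 2 ≤ Y := by
    have h1 : Real.log ((2 : ℝ) ^ 83) ≤ Real.log ((y : ℝ) ^ 5) := by
      apply Real.log_le_log (by positivity)
      calc (2 : ℝ) ^ 83 ≤ 126505 ^ 5 := by norm_num
        _ ≤ (y : ℝ) ^ 5 := pow_le_pow_left₀ (by norm_num) hyR 5
    rw [Real.log_pow, Real.log_pow] at h1
    have := Real.log_two_gt_d9
    push_cast at h1
    linarith
  obtain ⟨R, hR1, hR2⟩ : ∃ R : ℕ, 4 * ρ ≤ R ∧ (R : ℝ) ≤ 4 * ρ + 1 :=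
    ⟨⌈4 * ρ⌉₊, Nat.le_ceil _, (Nat.ceil_lt_add_one (by positivity)).le⟩
  obtain ⟨S0, hS1, hS2⟩ : ∃ S0 : ℕ, 2 * ρ + 5 / 2 * Y ≤ S0 ∧ (S0 : ℝ) ≤ 2 * ρ + 5 / 2 * Y + 1 :=
    ⟨⌈2 * ρ + 5 / 2 * Y⌉₊, Nat.le_ceil _, (Nat.ceil_lt_add_one (by positivity)).le⟩
  have hRpos : 1 ≤ R := by
    have : (1 : ℝ) ≤ R := by linarith
    exact_mod_cast this
  have hSpos : 1 ≤ S0 := by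
    have : (1 : ℝ) ≤ S0 := by linarith
    exact_mod_cast this
  have hM : 1 ≤ R * S0 := Nat.mul_pos hRpos hSpos
  obtain ⟨K, hK1, hKa, hKb, hKc⟩ : ∃ K : ℕ, 1 ≤ K ∧ 7 * (K - 1) < 4 * (R * S0) ∧
      4 * (R * S0) ≤ 7 * K ∧ 7 * K ≤ 4 * (R * S0) + 6 :=
    ⟨(4 * (R * S0) - 1) / 7 + 1, by omega, by omega, by omega, by omega⟩
  have ht : 0 ≤ ρ - 79 / 10 := by linarith
  have h3R : 3 * R ≤ p := by
    have h : 12 * ρ + 3 ≤ ρ ^ 6 / 64 := by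
      obtain ⟨t, ht', rfl⟩ : ∃ t, 0 ≤ t ∧ ρ = t + 79 / 10 := ⟨ρ - 79 / 10, ht, by ring⟩
      have : 0 ≤ (t + 79 / 10) ^ 6 / 64 - (12 * (t + 79 / 10) + 3) := by
        ring_nf
        positivity
      linarith
    have : (3 : ℝ) * R ≤ p := by rw [hρp]; linarith
    exact_mod_cast this
  have hlogρ : Real.log ρ ≤ ρ / 8 + 27 / 25 := by
    have h1 := Real.log_le_sub_one_of_pos (x := ρ / 8) (by positivity)
    rw [Real.log_div (by positivity) (by norm_num)] at h1
    have h2 : Real.log 8 = 3 * Real.log 2 := by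
      rw [show (8 : ℝ) = 2 ^ 3 by norm_num, Real.log_pow]; norm_num
    have := Real.log_two_lt_d9
    linarith
  have hlogρ0 : 0 ≤ Real.log ρ := Real.log_nonneg (by linarith)
  have hnR : (n : ℝ) = (ρ ^ 6 / 64 - 1) / 2 := by
    rw [← hρp, hn]; push_cast; ring
  have hKR : (7 * K : ℝ) ≤ (16 * ρ + 4) * (2 * ρ + 5 / 2 * Y + 1) + 6 := by
    have h1 : (7 * K : ℝ) ≤ 4 * (R * S0) + 6 := by exact_mod_cast hKc
    have h2 : (R : ℝ) * S0 ≤ (4 * ρ + 1) * (2 * ρ + 5 / 2 * Y + 1) :=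
      mul_le_mul hR2 hS2 (by positivity) (by positivity)
    linarith
  have hbig : (7 * K : ℝ) * Real.log ρ + Real.log Real.pi ≤ n * Y := by
    have h1 : (7 * K : ℝ) * Real.log ρ ≤
        ((16 * ρ + 4) * (2 * ρ + 5 / 2 * Y + 1) + 6) * (ρ / 8 + 27 / 25) :=
      mul_le_mul hKR hlogρ hlogρ0 (by positivity)
    have h2 : Real.log Real.pi ≤ 3 := by
      have := Real.log_le_sub_one_of_pos Real.pi_pos
      have := Real.pi_lt_four
      linarith
    have h3 : ((16 * ρ + 4) * (2 * ρ + 5 / 2 * Y + 1) + 6) * (ρ / 8 + 27 / 25) + 3 ≤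
        (ρ ^ 6 / 64 - 1) / 2 * Y := by
      obtain ⟨t, ht', rfl⟩ : ∃ t, 0 ≤ t ∧ ρ = t + 79 / 10 := ⟨ρ - 79 / 10, ht, by ring⟩
      obtain ⟨Z, hZ', hZ⟩ : ∃ Z, 0 ≤ Z ∧ Y = Z + 23 / 2 := ⟨Y - 23 / 2, by linarith, by ring⟩
      rw [hZ]
      have : 0 ≤ ((t + 79 / 10) ^ 6 / 64 - 1) / 2 * (Z + 23 / 2) -
        (((16 * (t + 79 / 10) + 4) * (2 * (t + 79 / 10) + 5 / 2 * (Z + 23 / 2) + 1) + 6) * ((t + 79 / 10) / 8 + 27 / 25) + 3) := by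
        ring_nf
        positivity
      linarith
    rw [hnR]
    linarith
  have hpos : (0 : ℝ) < y := by linarith
  have hρpos : 0 < ρ := by linarith
  have hpow : Real.pi * ρ ^ (7 * K) ≤ (y : ℝ) ^ n := by
    rw [← Real.log_le_log_iff (by positivity) (by positivity), Real.log_mul (by positivity) (by positivity),
      Real.log_pow, Real.log_pow]
    push_cast
    linarith
  have hlam' : |lam| * ρ ^ (7 * K) ≤ 1 := by
    have h1 : |lam| * (Real.pi * ρ ^ (7 * K)) ≤ |lam| * (y : ℝ) ^ n :=
      mul_le_mul_of_nonneg_left hpow (abs_nonneg _)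
    have h2 : Real.pi * (|lam| * ρ ^ (7 * K)) ≤ Real.pi * 1 := by linarith
    exact le_of_mul_le_mul_left h2 Real.pi_pos
  have hc := core p K R (S0 + 1) hp k hk0 hkp h3R hRpos (by omega) g θ lam hgθ hk hg
    (by
      have : 2 * R * (2 * (S0 + 1) - 2) = 4 * (R * S0) := by
        rw [show 2 * (S0 + 1) - 2 = 2 * S0 by omega]; ring
      rw [this]; exact hKa) y hy1 hy2 (by omega) ρ (by linarith) hlam' (R / 2 + (S0 + 1 : ℕ)) rfl
  have hl := log_ineq K R y ρ _ _ hK1 (by linarith) (by positivity) (by omega) hc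
  refine numeric K R S0 p ρ Y (R / 2 + (S0 + 1 : ℕ)) hρ hρp hY hR1 hS1 (by push_cast; ring) hK1 ?_ hl
  have : (4 * (R * S0) : ℝ) ≤ 7 * K := by exact_mod_cast hKb
  linarith

theorem I_zpow_exp (j : ℤ) : Complex.I ^ j = Complex.exp (Complex.I * ((j * (Real.pi / 2) : ℝ) : ℂ)) := by
  have h : Complex.I = Complex.exp (Complex.I * (Real.pi / 2)) := by
    rw [mul_comm]; exact Complex.exp_pi_div_two_mul_I.symm
  conv_lhs => rw [h]
  rw [← Complex.exp_int_mul]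
  congr 1
  push_cast
  ring

theorem exists_rot (z : ℂ) (hz : ‖z‖ = 1) :
    ∃ (j : ℤ) (θ : ℝ), |θ| ≤ Real.pi / 4 ∧ z = Complex.I ^ j * Complex.exp (Complex.I * θ) := by
  refine ⟨round (z.arg / (Real.pi / 2)), z.arg - round (z.arg / (Real.pi / 2)) * (Real.pi / 2), ?_, ?_⟩
  · have h := abs_sub_round (z.arg / (Real.pi / 2))
    have hpi := Real.pi_pos
    have h2 : z.arg - round (z.arg / (Real.pi / 2)) * (Real.pi / 2) =
        (z.arg / (Real.pi / 2) - round (z.arg / (Real.pi / 2))) * (Real.pi / 2) := by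
      rw [sub_mul, div_mul_cancel₀ _ (by positivity)]
    rw [h2, abs_mul, abs_of_pos (show 0 < Real.pi / 2 by positivity)]
    nlinarith
  · rw [I_zpow_exp, ← Complex.exp_add, ← mul_add, ← Complex.ofReal_add]
    have h := Complex.norm_mul_exp_arg_mul_I z
    rw [hz] at h
    simp only [Complex.ofReal_one, one_mul] at h
    conv_lhs => rw [← h]
    congr 1
    rw [mul_comm]
    congr 2
    ring

theorem arg_bound (w : ℂ) (hw : ‖w‖ = 1) :
    ∃ l : ℝ, w = Complex.exp (Complex.I * l) ∧ |l| ≤ Real.pi / 2 * ‖w - 1‖ := by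
  have h := Complex.norm_mul_exp_arg_mul_I w
  rw [hw] at h
  simp only [Complex.ofReal_one, one_mul] at h
  rw [mul_comm] at h
  refine ⟨w.arg, h.symm, ?_⟩
  have h2 := Complex.norm_exp_I_mul_ofReal_sub_one w.arg
  rw [h] at h2
  rw [h2, Real.norm_eq_abs, abs_mul, abs_two]
  have h3 := Complex.abs_arg_le_pi w
  have h4 : 2 / Real.pi * |w.arg / 2| ≤ |Real.sin (w.arg / 2)| := by
    apply Real.mul_abs_le_abs_sin
    rw [abs_div, abs_two]; linarith
  rw [abs_div, abs_two] at h4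
  have hpi := Real.pi_pos
  have h5 : |w.arg| = Real.pi * (2 / Real.pi * (|w.arg| / 2)) := by field_simp
  rw [h5]
  have := mul_le_mul_of_nonneg_left h4 hpi.le
  linarith

theorem from_gauss (p n y : ℕ) (hp : p.Prime) (hp1 : 3804 ≤ p) (hn : p = 2 * n + 1)
    (hy : 126505 ≤ y) (α β : ℂ) (hα : α ∈ GaussianInt.toComplex.range)
    (hβ : β ∈ GaussianInt.toComplex.range) (hαβ : α * β = y) (hnorm : ‖α‖ = ‖β‖)
    (hne : ∀ s : ℤ, α ≠ Complex.I ^ s * β)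
    (hη : ‖Complex.I * (α / β) ^ p - 1‖ * (y : ℝ) ^ n ≤ 2) : False := by
  have hyR : (126505 : ℝ) ≤ y := by exact_mod_cast hy
  have hpR : (3804 : ℝ) ≤ p := by exact_mod_cast hp1
  have hyC : (y : ℂ) ≠ 0 := by
    have : y ≠ 0 := by omega
    exact_mod_cast this
  have hα0 : α ≠ 0 := by rintro rfl; simp at hαβ; exact hyC hαβ.symm
  have hβ0 : β ≠ 0 := by rintro rfl; simp at hαβ; exact hyC hαβ.symm
  have hnβ : ‖β‖ * ‖β‖ = y := by
    have := congrArg norm hαβ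
    rw [norm_mul, hnorm] at this
    simpa using this
  have hβ1 : ‖β‖ ≤ y := by nlinarith [norm_nonneg β]
  have hγ : ‖α / β‖ = 1 := by rw [norm_div, hnorm, div_self (norm_ne_zero_iff.mpr hβ0)]
  obtain ⟨j, θ, hθ, hz⟩ := exists_rot (α / β) hγ
  set g := Complex.exp (Complex.I * θ) with hgdef
  have hI0 : ∀ s : ℤ, Complex.I ^ s ≠ 0 := fun s => zpow_ne_zero _ Complex.I_ne_zero
  have hα' : α = Complex.I ^ j * g * β := by
    rw [← hz, div_mul_cancel₀ _ hβ0]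
  have hg' : g = Complex.I ^ (-j) * (α / β) := by
    rw [hz, ← mul_assoc, ← zpow_add₀ Complex.I_ne_zero]; simp
  obtain ⟨l, hl, hlb⟩ := arg_bound (Complex.I * (α / β) ^ p) (by rw [norm_mul, norm_pow, hγ, Complex.norm_I]; simp)
  have hlam : |l| * (y : ℝ) ^ n ≤ Real.pi := by
    have hpi := Real.pi_pos
    have h1 : |l| * (y : ℝ) ^ n ≤ Real.pi / 2 * ‖Complex.I * (α / β) ^ p - 1‖ * (y : ℝ) ^ n :=
      mul_le_mul_of_nonneg_right hlb (by positivity)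
    have h2 := mul_le_mul_of_nonneg_left hη (show 0 ≤ Real.pi / 2 by positivity)
    linarith
  have hyn : (y : ℝ) ≤ (y : ℝ) ^ n := by
    exact le_self_pow₀ (by linarith) (by omega)
  have hly : |l| * y ≤ Real.pi :=
    (mul_le_mul_of_nonneg_left hyn (abs_nonneg _)).trans hlam
  have hpi4 := Real.pi_lt_four
  have hpi3 := Real.pi_gt_three
  have hlsmall : |l| ≤ 1 / 10000 := by
    have h0 := abs_nonneg l
    nlinarith
  have hexp : Complex.exp (Complex.I * ((p * θ : ℝ) : ℂ)) =
      Complex.exp (Complex.I * (((-(j * p) - 1 : ℤ) * (Real.pi / 2) + l : ℝ) : ℂ)) := by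
    have h1 : Complex.exp (Complex.I * ((p * θ : ℝ) : ℂ)) = g ^ p := by
      rw [hgdef, ← Complex.exp_nat_mul]; congr 1; push_cast; ring
    rw [h1, Complex.ofReal_add, mul_add, Complex.exp_add, ← I_zpow_exp, ← hl, hg', mul_pow,
      ← zpow_natCast (Complex.I ^ (-j)), ← zpow_mul, ← mul_assoc, ← zpow_add_one₀ Complex.I_ne_zero]
    congr 2
    ring
  obtain ⟨N, hN⟩ := Complex.exp_eq_exp_iff_exists_int.mp hexp
  have hk : p * θ = ((-(j * p) - 1 + 4 * N : ℤ) : ℝ) * (Real.pi / 2) + l := by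
    have h1 : Complex.I * ((p * θ : ℝ) : ℂ) = Complex.I *
        ((((-(j * p) - 1 + 4 * N : ℤ) : ℝ) * (Real.pi / 2) + l : ℝ) : ℂ) := by
      rw [hN]; push_cast; ring
    exact_mod_cast mul_left_cancel₀ Complex.I_ne_zero h1
  generalize (-(j * p) - 1 + 4 * N : ℤ) = k at hk
  have hk0 : k ≠ 0 := by
    rintro rfl
    simp only [Int.cast_zero, zero_mul, zero_add] at hk
    have hz1 : β * (g - 1) ∈ GaussianInt.toComplex.range := by
      have : β * (g - 1) = Complex.I ^ (-j) * α - β := by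
        rw [hg']; field_simp
      rw [this]
      exact sub_mem (mul_mem (gauss_I_zpow _) hα) hβ
    have hz0 : β * (g - 1) ≠ 0 := by
      intro h
      rcases mul_eq_zero.mp h with h | h
      · exact hβ0 h
      · apply hne j
        rw [hα', sub_eq_zero.mp h]; ring
    have h1 := gauss_norm_ge _ hz1 hz0
    have h2 : ‖g - 1‖ ≤ |θ| := by
      have := Real.norm_exp_I_mul_ofReal_sub_one_le (x := θ)
      simpa using this
    have h3 : p * |θ| = |l| := by
      rw [← hk, abs_mul, Nat.abs_cast]
    rw [norm_mul] at h1
    have h4 : ‖β‖ * ‖g - 1‖ ≤ y * |θ| := mul_le_mul hβ1 h2 (norm_nonneg _) (by positivity)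
    have h5 : (p : ℝ) * (y * |θ|) ≤ Real.pi := by
      calc (p : ℝ) * (y * |θ|) = |l| * y := by rw [← h3]; ring
        _ ≤ Real.pi := hly
    nlinarith
  have hkp : 2 * |k| ≤ p := by
    have h1 : |(k : ℝ) * (Real.pi / 2)| ≤ p * (Real.pi / 4) + 1 / 10000 := by
      have : (k : ℝ) * (Real.pi / 2) = p * θ - l := by linarith
      rw [this]
      refine (abs_sub _ _).trans ?_
      rw [abs_mul, Nat.abs_cast]
      have := mul_le_mul_of_nonneg_left hθ (show (0 : ℝ) ≤ p by positivity)
      linarith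
    rw [abs_mul, abs_of_pos (show 0 < Real.pi / 2 by positivity)] at h1
    have h2 : (2 * |k| : ℝ) < p + 1 := by
      by_contra hcon
      push Not at hcon
      push_cast at hcon
      nlinarith
    have h3 : (2 * |k| : ℤ) < p + 1 := by exact_mod_cast h2
    omega
  refine params p hp hp1 k hk0 hkp g θ l hgdef hk ?_ y ?_ ?_ hy n hn hlam
  · intro s hs
    apply hne (j + s)
    rw [hα', hs, zpow_add₀ Complex.I_ne_zero, zpow_natCast]
  · have : (y : ℂ) * g = Complex.I ^ (-j) * (α * α) := by
      rw [hg', ← hαβ]; field_simp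
    rw [this]
    exact mul_mem (gauss_I_zpow _) (mul_mem hα hα)
  · have : (y : ℂ) * g⁻¹ = Complex.I ^ j * (β * β) := by
      rw [hg', ← hαβ, zpow_neg]
      have := hI0 j
      field_simp
    rw [this]
    exact mul_mem (gauss_I_zpow _) (mul_mem hβ hβ)

theorem nondeg_arith (q m x y p : ℕ) (u v d : ℤ) (hp : 1 ≤ p)
    (hq : Nat.Prime q) (hoq : Odd q) (hm : 1 ≤ m) (hcop : Nat.gcd x y = 1)
    (heq : x ^ 2 + q ^ (2 * m) = 2 * y ^ p)
    (hyuv : (y : ℤ) = u ^ 2 + v ^ 2) (hd : d = 1 ∨ d = -1)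
    (hsum : u + d * v = (q : ℤ) ^ m ∨ u + d * v = -(q : ℤ) ^ m)
    (h0 : u * v * ((u - v) * (u + v)) = 0) : False := by
  have hodd : Odd ((q : ℤ) ^ m) := by
    have : Odd (q : ℤ) := by exact_mod_cast hoq
    exact this.pow
  have hsq : (u + d * v) ^ 2 = ((q : ℤ) ^ m) ^ 2 := by
    rcases hsum with h | h <;> rw [h]; ring
  rcases mul_eq_zero.mp h0 with h | h
  · have hd2 : d ^ 2 = 1 := by rcases hd with rfl | rfl <;> norm_num
    have hyq : (y : ℤ) = ((q : ℤ) ^ m) ^ 2 := by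
      linear_combination hyuv + hsq - 2 * d * h - v ^ 2 * hd2
    have hyq' : y = (q ^ m) ^ 2 := by exact_mod_cast hyq
    have hqy : q ∣ y := by
      rw [hyq', ← pow_mul]
      exact dvd_pow_self q (by omega)
    have hqx : q ∣ x := by
      apply hq.dvd_of_dvd_pow (n := 2)
      rw [Nat.dvd_add_iff_left (n := q ^ (2 * m)) (dvd_pow_self q (by omega)), heq]
      exact Dvd.dvd.mul_left (dvd_pow hqy (by omega)) 2
    have := Nat.dvd_gcd hqx hqy
    rw [hcop] at this
    exact hq.one_lt.ne' (Nat.dvd_one.mp this)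
  · obtain ⟨c, hc⟩ := hodd
    rcases mul_eq_zero.mp h with h | h <;> rcases hd with rfl | rfl <;> rcases hsum with h' | h' <;>
      omega

theorem bound_p_large_qm (p q m x y : ℕ) (u v : ℤ)
    (hp : Nat.Prime p) (hop : Odd p) (hq : Nat.Prime q) (hoq : Odd q)
    (hm : 1 ≤ m) (hx : 0 < x) (hy : 0 < y) (hcop : Nat.gcd x y = 1)
    (heq : x ^ 2 + q ^ (2 * m) = 2 * y ^ p)
    (hyuv : (y : ℤ) = u ^ 2 + v ^ 2)
    (hxF : (x : ℤ) = Ffun p u v)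
    (hqG : (q : ℤ) ^ m = Gfun p u v)
    (hsum : u + d4 p * v = (q : ℤ) ^ m ∨ u + d4 p * v = -(q : ℤ) ^ m)
    (hbig : 503 ≤ q ^ m) :
    p ≤ 3803 := by
  by_contra hcon
  push Not at hcon
  obtain ⟨n, hn⟩ := hop
  have hd : d4 p = 1 ∨ d4 p = -1 := by unfold d4; split_ifs <;> simp
  have hsq : (u + d4 p * v) ^ 2 = ((q : ℤ) ^ m) ^ 2 := by
    rcases hsum with h | h <;> rw [h]; ring
  have hd2 : (d4 p) ^ 2 = 1 := by rcases hd with h | h <;> rw [h] <;> norm_num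
  have h2y : ((q : ℤ) ^ m) ^ 2 ≤ 2 * y := by
    have : 2 * (y : ℤ) - ((q : ℤ) ^ m) ^ 2 = (u - d4 p * v) ^ 2 := by
      linear_combination 2 * hyuv + hsq - 2 * v ^ 2 * hd2
    nlinarith [sq_nonneg (u - d4 p * v)]
  have hbigZ : (503 : ℤ) ≤ (q : ℤ) ^ m := by exact_mod_cast hbig
  have hyb : 126505 ≤ y := by
    have : (503 : ℤ) ^ 2 ≤ 2 * y := (pow_le_pow_left₀ (by norm_num) hbigZ 2).trans h2y
    norm_num at this
    omega
  set a : GaussianInt := ⟨u, v⟩ with ha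
  have hG : (⟨1, 1⟩ : GaussianInt) * a ^ p = ⟨x, (q : ℤ) ^ m⟩ := by
    apply Zsqrtd.ext
    · exact hxF.symm
    · exact hqG.symm
  have hG1 : (1 + Complex.I) * ((u : ℂ) + v * Complex.I) ^ p = x + (q : ℂ) ^ m * Complex.I := by
    have := congrArg GaussianInt.toComplex hG
    rw [map_mul, map_pow, GaussianInt.toComplex_def', GaussianInt.toComplex_def',
      GaussianInt.toComplex_def'] at this
    simpa using this
  have hG2 : (1 - Complex.I) * ((u : ℂ) - v * Complex.I) ^ p = x - (q : ℂ) ^ m * Complex.I := by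
    have := congrArg (starRingEnd ℂ) hG1
    simpa [sub_eq_add_neg] using this
  have hI2 : Complex.I ^ 2 = -1 := Complex.I_sq
  have hyC : (y : ℂ) = (u : ℂ) ^ 2 + (v : ℂ) ^ 2 := by exact_mod_cast congrArg (Int.cast : ℤ → ℂ) hyuv
  set α : ℂ := (u : ℂ) + v * Complex.I with hαd
  set β : ℂ := (u : ℂ) - v * Complex.I with hβd
  have hαβ : α * β = y := by
    rw [hαd, hβd, hyC]; linear_combination -(v : ℂ) ^ 2 * hI2
  have hconj : β = (starRingEnd ℂ) α := by simp [hαd, hβd, sub_eq_add_neg]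
  have hnorm : ‖α‖ = ‖β‖ := by rw [hconj, Complex.norm_conj]
  have hα : α ∈ GaussianInt.toComplex.range := ⟨⟨u, v⟩, by rw [GaussianInt.toComplex_def']⟩
  have hβ : β ∈ GaussianInt.toComplex.range :=
    ⟨⟨u, -v⟩, by rw [GaussianInt.toComplex_def']; push_cast; rw [hβd]; ring⟩
  have hyR : (126505 : ℝ) ≤ y := by exact_mod_cast hyb
  have hyC0 : (y : ℂ) ≠ 0 := by exact_mod_cast hy.ne'
  have hβ0 : β ≠ 0 := by intro h; rw [h, mul_zero] at hαβ; exact hyC0 hαβ.symm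
  have hnβ : ‖β‖ ^ 2 = y := by
    have := congrArg norm hαβ
    rw [norm_mul, hnorm] at this
    rw [sq]
    simpa using this
  refine from_gauss p n y hp (by omega) hn hyb α β hα hβ hαβ hnorm ?_ ?_
  · intro s hs
    have h4 : α ^ 4 = β ^ 4 := by
      rw [hs, mul_pow, ← zpow_natCast (Complex.I ^ s), ← zpow_mul, mul_comm s, zpow_mul]
      simp [Complex.I_pow_four]
    have h5 : (u : ℂ) * v * ((u - v) * (u + v)) = 0 := by
      have h6 : Complex.I * ((u : ℂ) * v * ((u - v) * (u + v))) = 0 := by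
        have h7 : α ^ 4 - β ^ 4 = 8 * u * v * Complex.I * (u ^ 2 + v ^ 2 * Complex.I ^ 2) := by
          rw [hαd, hβd]; ring
        rw [h4, hI2] at h7
        linear_combination -h7 / 8
      exact (mul_eq_zero.mp h6).resolve_left Complex.I_ne_zero
    have h6 : u * v * ((u - v) * (u + v)) = 0 := by exact_mod_cast h5
    exact nondeg_arith q m x y p u v (d4 p) hp.one_le hq hoq hm hcop heq hyuv hd hsum h6
  · set E := Complex.I * (α / β) ^ p - 1 with hE
    have hE1 : E * ((1 - Complex.I) * β ^ p) = 2 * (q : ℂ) ^ m * Complex.I := by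
      have h1 : (α / β) ^ p * β ^ p = α ^ p := by rw [← mul_pow, div_mul_cancel₀ _ hβ0]
      have h2 : E * ((1 - Complex.I) * β ^ p) =
          Complex.I * (1 - Complex.I) * ((α / β) ^ p * β ^ p) - (1 - Complex.I) * β ^ p := by
        rw [hE]; ring
      rw [h2, h1, hG2]
      linear_combination hG1 - α ^ p * hI2
    have hE2 := congrArg norm hE1
    have hc : ‖(1 : ℂ) - Complex.I‖ ^ 2 = 2 := by
      rw [← Complex.normSq_eq_norm_sq, Complex.normSq_apply]; norm_num
    rw [norm_mul, norm_mul, norm_pow, norm_mul, norm_mul, Complex.norm_I, norm_pow,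
      Complex.norm_natCast, hn, pow_succ, pow_mul, hnβ] at hE2
    have hc0 : 0 < ‖(1 : ℂ) - Complex.I‖ := by
      rcases (norm_nonneg ((1 : ℂ) - Complex.I)).lt_or_eq with h | h
      · exact h
      · rw [← h] at hc; norm_num at hc
    have hb0 : 0 < ‖β‖ := norm_pos_iff.mpr hβ0
    have hqm : (q : ℝ) ^ m ≤ ‖(1 : ℂ) - Complex.I‖ * ‖β‖ := by
      refine (pow_le_pow_iff_left₀ (by positivity) (by positivity) two_ne_zero).mp ?_
      rw [mul_pow, hc, hnβ]
      exact_mod_cast h2y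
    have hC2 : ‖(2 : ℂ)‖ = 2 := by simp
    rw [hC2] at hE2
    have hcb : 0 < ‖(1 : ℂ) - Complex.I‖ * ‖β‖ := by positivity
    refine le_of_mul_le_mul_right ?_ hcb
    linarith
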